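/- Let G be a finite group and k a field of characteristic p dividing |G|. If there exists a finitely generated indecomposable non-projective kG-module N belonging to the thick subcategory generated by k in stmod(kG) such that N is not stably isomorphic to Ω^i k for any integer i, then there exists a nonzero map φ: N → ΩN in the stable category inducing the zero map on Tate cohomology Ĥ*(G, N) → Ĥ*(G, ΩN); in particular the generating hypothesis fails for kG. -/

import Mathlib

open CategoryTheory

namespace StmodGH

/-- The trivial `kG`-module `k`, as a module over the group algebra. -/
noncomputable def triv (k G : Type) [Field k] [Group G] : ModuleCat (MonoidAlgebra k G) :=
  ModuleCat.of _ (Representation.trivial k (G := G) (V := k)).asModule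

variable {A : Type} [Ring A]

/-- A map is zero in the stable module category iff it factors through a projective. -/
def StablyZero {M N : ModuleCat A} (f : M ⟶ N) : Prop :=
  ∃ P : ModuleCat A, Projective P ∧ ∃ (g : M ⟶ P) (h : P ⟶ N), f = g ≫ h

/-- Two modules are isomorphic in the stable module category. -/
def StablyIso (M N : ModuleCat A) : Prop :=
  ∃ (f : M ⟶ N) (g : N ⟶ M), StablyZero (f ≫ g - 𝟙 M) ∧ StablyZero (g ≫ f - 𝟙 N)

/-- A short exact sequence `0 → X → Y → Z → 0` of modules. -/
structure SES (X Y Z : ModuleCat A) where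
  i : X ⟶ Y
  p : Y ⟶ Z
  inj : Function.Injective i
  surj : Function.Surjective p
  exact : ∀ y : Y, p y = 0 ↔ ∃ x, i x = y

/-- `Ω` is a family of syzygies/cosyzygies of `M`: `Ω 0 ≃ M` stably, and each
`Ω (i+1)` is the kernel of a surjection from a (finitely generated) projective onto `Ω i`. -/
def IsSyzygyFamily (M : ModuleCat A) (Ω : ℤ → ModuleCat A) : Prop :=
  (∀ i, Module.Finite A (Ω i)) ∧ StablyIso (Ω 0) M ∧
    ∀ i : ℤ, ∃ P : ModuleCat A, Projective P ∧ Nonempty (SES (Ω (i + 1)) P (Ω i))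

/-- Indecomposability, via idempotent endomorphisms. -/
def Indecomp (M : ModuleCat A) : Prop :=
  ¬ Limits.IsZero M ∧ ∀ f : M ⟶ M, f ≫ f = f → f = 0 ∨ f = 𝟙 M

/-- Membership in the thick subcategory of the stable module category generated by `G₀`:
the smallest class containing `G₀`, containing the (stably trivial) projective modules,
closed under stable isomorphism, under exact triangles (equivalently, two-out-of-three for
short exact sequences), and under direct summands. -/
inductive InThick (G₀ : ModuleCat A) : ModuleCat A → Prop
  | gen : InThick G₀ G₀
  | proj (P : ModuleCat A) : Projective P → InThick G₀ P
  | iso {M N : ModuleCat A} : StablyIso M N → InThick G₀ M → InThick G₀ N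
  | ext₁ {X Y Z : ModuleCat A} : SES X Y Z → InThick G₀ X → InThick G₀ Y → InThick G₀ Z
  | ext₂ {X Y Z : ModuleCat A} : SES X Y Z → InThick G₀ X → InThick G₀ Z → InThick G₀ Y
  | ext₃ {X Y Z : ModuleCat A} : SES X Y Z → InThick G₀ Y → InThick G₀ Z → InThick G₀ X
  | summand {M N : ModuleCat A} : (∃ (s : M ⟶ N) (r : N ⟶ M), s ≫ r = 𝟙 M) →
      InThick G₀ N → InThick G₀ M

/-- A short exact sequence `0 → X → B → N → 0` is almost split: it is non-split, has
indecomposable end terms, and every map to `N` that is not a split epimorphism factors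
through the middle term `B`. -/
def IsAlmostSplit {X B N : ModuleCat A} (s : SES X B N) : Prop :=
  Indecomp X ∧ Indecomp N ∧ (¬ ∃ sec : N ⟶ B, sec ≫ s.p = 𝟙 N) ∧
    ∀ (M : ModuleCat A) (f : M ⟶ N),
      (¬ ∃ sec : N ⟶ M, sec ≫ f = 𝟙 N) → ∃ g : M ⟶ B, g ≫ s.p = f

/-- The generating hypothesis for `kG`: every map in the thick subcategory generated by the
trivial module which induces the zero map on Tate cohomology
`Ĥ^i(G,−) = Hom_stmod(Ω^i k, −)` is zero in the stable module category. -/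
def GHolds (k G : Type) [Field k] [Group G] [Fintype G] : Prop :=
  ∀ Ωk : ℤ → ModuleCat (MonoidAlgebra k G), IsSyzygyFamily (triv k G) Ωk →
    ∀ M N : ModuleCat (MonoidAlgebra k G), InThick (triv k G) M → InThick (triv k G) N →
      ∀ f : M ⟶ N, (∀ (i : ℤ) (g : Ωk i ⟶ M), StablyZero (g ≫ f)) → StablyZero f

open scoped TensorProduct

section Transfer

variable {k G : Type} [Field k] [Group G]
variable {M : Type} [AddCommGroup M] [Module k M] [Module (MonoidAlgebra k G) M]
  [IsScalarTower k (MonoidAlgebra k G) M]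
variable {N : Type} [AddCommGroup N] [Module k N] [Module (MonoidAlgebra k G) N]
  [IsScalarTower k (MonoidAlgebra k G) N]
variable {L : Type} [AddCommGroup L] [Module k L] [Module (MonoidAlgebra k G) L]
  [IsScalarTower k (MonoidAlgebra k G) L]

lemma comp_conjugate (σ : N →ₗ[k] L) (x : M →ₗ[k] N) (γ : G) :
    σ ∘ₗ x.conjugate γ = (σ.conjugate γ⁻¹ ∘ₗ x).conjugate γ := by
  ext m
  simp [LinearMap.conjugate_apply, smul_smul, MonoidAlgebra.single_mul_single,
    ← MonoidAlgebra.one_def]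

lemma conjugate_restrictScalars (f : M →ₗ[MonoidAlgebra k G] N) (γ : G) :
    (f.restrictScalars k).conjugate γ = f.restrictScalars k := by
  ext n
  simp [LinearMap.conjugate_apply, smul_smul, MonoidAlgebra.single_mul_single,
    ← MonoidAlgebra.one_def]

lemma conjugate_comp_left (f : N →ₗ[MonoidAlgebra k G] L) (σ : M →ₗ[k] N) (γ : G) :
    f.restrictScalars k ∘ₗ σ.conjugate γ = (f.restrictScalars k ∘ₗ σ).conjugate γ := by
  ext n
  simp [LinearMap.conjugate_apply]

variable (k G M) in
/-- The action map `kG ⊗ M → M`. -/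
noncomputable def actionMap :
    TensorProduct k (MonoidAlgebra k G) M →ₗ[MonoidAlgebra k G] M :=
  TensorProduct.AlgebraTensorModule.lift
    { toFun := fun a ↦ Algebra.lsmul k k M a
      map_add' := fun a b ↦ by ext; simp
      map_smul' := fun a b ↦ by ext; simp }

lemma actionMap_tmul (a : MonoidAlgebra k G) (m : M) : actionMap k G M (a ⊗ₜ m) = a • m :=
  rfl

/-- The projection of `kG` onto the span of the identity element. -/
noncomputable def unitProj (k G : Type) [Field k] [Group G] :
    MonoidAlgebra k G →ₗ[k] MonoidAlgebra k G :=
  MonoidAlgebra.lsingle (R := k) (1 : G) ∘ₗ Finsupp.lapply 1 ∘ₗ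
    (MonoidAlgebra.coeffLinearEquiv k).toLinearMap

variable [Fintype G]

/-- The transfer `θ ↦ ∑ g⁻¹ θ g` from `k`-linear maps to `kG`-linear maps. -/
noncomputable def transfer : (M →ₗ[k] N) →+ (M →ₗ[MonoidAlgebra k G] N) where
  toFun θ := θ.sumOfConjugatesEquivariant G
  map_zero' := by
    ext m
    simp [LinearMap.sumOfConjugatesEquivariant_apply, LinearMap.conjugate_apply]
  map_add' θ θ' := by
    ext m
    simp [LinearMap.sumOfConjugatesEquivariant_apply, LinearMap.conjugate_apply,
      Finset.sum_add_distrib]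

lemma transfer_apply (θ : M →ₗ[k] N) (m : M) :
    (transfer θ : M →ₗ[MonoidAlgebra k G] N) m =
      ∑ g : G, MonoidAlgebra.single g⁻¹ (1 : k) • θ (MonoidAlgebra.single g (1 : k) • m) :=
  LinearMap.sumOfConjugatesEquivariant_apply G θ m

lemma comp_transfer (f : N →ₗ[MonoidAlgebra k G] L) (θ : M →ₗ[k] N) :
    f ∘ₗ transfer θ = transfer (f.restrictScalars k ∘ₗ θ) := by
  ext m
  simp [transfer_apply]

lemma transfer_comp (θ : N →ₗ[k] L) (f : M →ₗ[MonoidAlgebra k G] N) :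
    transfer θ ∘ₗ f = transfer (θ ∘ₗ f.restrictScalars k) := by
  ext m
  simp [transfer_apply]

lemma transfer_conjugate (x : M →ₗ[k] N) (γ : G) :
    (transfer (x.conjugate γ) : M →ₗ[MonoidAlgebra k G] N) = transfer x := by
  ext m
  simp only [transfer_apply, LinearMap.conjugate_apply, smul_smul,
    MonoidAlgebra.single_mul_single, one_mul]
  refine Fintype.sum_bijective (γ * ·) (Group.mulLeft_bijective γ) _ _ fun i ↦ ?_
  simp

lemma trace_transfer_comp (a : M →ₗ[k] N) (b : N →ₗ[k] M) :
    LinearMap.trace k N ((transfer a : M →ₗ[MonoidAlgebra k G] N).restrictScalars k ∘ₗ b) =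
      LinearMap.trace k N (a ∘ₗ (transfer b : N →ₗ[MonoidAlgebra k G] M).restrictScalars k) := by
  have h₁ : (transfer a : M →ₗ[MonoidAlgebra k G] N).restrictScalars k ∘ₗ b =
      ∑ g : G, MonoidAlgebra.GroupSMul.linearMap k N g⁻¹ ∘ₗ
        (a ∘ₗ MonoidAlgebra.GroupSMul.linearMap k M g ∘ₗ b) := by
    ext n
    simp [transfer_apply, LinearMap.sum_apply]
  have h₂ : a ∘ₗ (transfer b : N →ₗ[MonoidAlgebra k G] M).restrictScalars k =
      ∑ g : G, (a ∘ₗ MonoidAlgebra.GroupSMul.linearMap k M g⁻¹ ∘ₗ b) ∘ₗ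
        MonoidAlgebra.GroupSMul.linearMap k N g := by
    ext n
    simp [transfer_apply, LinearMap.sum_apply]
  rw [h₁, h₂, map_sum, map_sum]
  refine Fintype.sum_bijective (·⁻¹) (Equiv.inv G).bijective _ _ fun g ↦ ?_
  rw [inv_inv]
  exact LinearMap.trace_mul_comm k _ _

lemma transfer_unitProj :
    (transfer (unitProj k G) : _ →ₗ[MonoidAlgebra k G] _) = LinearMap.id := by
  apply LinearMap.ext_ring
  rw [transfer_apply, Finset.sum_eq_single 1]
  · simp [unitProj, MonoidAlgebra.one_def, MonoidAlgebra.single_mul_single]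
  · intro g _ hg
    simp [unitProj, MonoidAlgebra.one_def, MonoidAlgebra.single_mul_single, hg]
  · simp

lemma exists_transfer_eq_id [Module.Projective (MonoidAlgebra k G) M] :
    ∃ η : M →ₗ[k] M, (transfer η : M →ₗ[MonoidAlgebra k G] M) = LinearMap.id := by
  have hsurj : Function.Surjective (actionMap k G M) :=
    fun m ↦ ⟨1 ⊗ₜ m, by simp [actionMap_tmul]⟩
  obtain ⟨σ, hσ⟩ := Module.projective_lifting_property (actionMap k G M) LinearMap.id hsurj
  have hη : (transfer (TensorProduct.map (unitProj k G) (LinearMap.id : M →ₗ[k] M)) :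
      TensorProduct k (MonoidAlgebra k G) M →ₗ[MonoidAlgebra k G] _) = LinearMap.id := by
    ext a
    have := LinearMap.congr_fun (transfer_unitProj (k := k) (G := G)) 1
    rw [transfer_apply] at this
    simp [transfer_apply, TensorProduct.smul_tmul', ← TensorProduct.sum_tmul] at this ⊢
    rw [this]
  refine ⟨(actionMap k G M).restrictScalars k ∘ₗ
    TensorProduct.map (unitProj k G) LinearMap.id ∘ₗ σ.restrictScalars k, ?_⟩
  rw [← comp_transfer, ← transfer_comp, hη, LinearMap.id_comp, hσ]

lemma transfer_eq_actionMap_comp (θ : M →ₗ[k] N) :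
    (transfer θ : M →ₗ[MonoidAlgebra k G] N) =
      actionMap k G N ∘ₗ transfer (TensorProduct.mk k (MonoidAlgebra k G) N 1 ∘ₗ θ) := by
  rw [comp_transfer]
  congr 1
  ext m
  simp [actionMap_tmul]

end Transfer

section LinearAlgebra

variable {R X Y Z W : Type} [Ring R] [AddCommGroup X] [Module R X] [AddCommGroup Y] [Module R Y]
  [AddCommGroup Z] [Module R Z] [AddCommGroup W] [Module R W]

lemma exists_comp_eq_of_range_le {i : X →ₗ[R] Y} (hi : Function.Injective i) {f : W →ₗ[R] Y}
    (h : ∀ w, ∃ x, i x = f w) : ∃ g : W →ₗ[R] X, i ∘ₗ g = f := by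
  refine ⟨(LinearEquiv.ofInjective i hi).symm.toLinearMap ∘ₗ
    f.codRestrict (LinearMap.range i) h, ?_⟩
  ext w
  exact congrArg Subtype.val ((LinearEquiv.ofInjective i hi).apply_symm_apply
    (f.codRestrict (LinearMap.range i) h w))

lemma exists_comp_eq_of_ker_le {p : Y →ₗ[R] Z} (hp : Function.Surjective p) {f : Y →ₗ[R] W}
    (h : ∀ y, p y = 0 → f y = 0) : ∃ g : Z →ₗ[R] W, g ∘ₗ p = f := by
  refine ⟨(LinearMap.ker p).liftQ f h ∘ₗ (p.quotKerEquivOfSurjective hp).symm.toLinearMap, ?_⟩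
  ext y
  have : (p.quotKerEquivOfSurjective hp).symm (p y) = Submodule.Quotient.mk y := by
    rw [LinearEquiv.symm_apply_eq]
    rfl
  rw [LinearMap.comp_apply, LinearMap.comp_apply, LinearEquiv.coe_coe, this]
  exact (LinearMap.ker p).liftQ_apply f y

lemma isLocalRing_end_of_idempotents [IsNoetherian R X] [IsArtinian R X] [Nontrivial X]
    (h : ∀ e : Module.End R X, e * e = e → e = 0 ∨ e = 1) : IsLocalRing (Module.End R X) := by
  refine .of_isUnit_or_isUnit_one_sub_self fun a ↦ ?_
  obtain ⟨n, hn, hn1⟩ := (a.eventually_isCompl_ker_pow_range_pow.and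
    (Filter.eventually_ge_atTop 1)).exists
  rcases h _ (Submodule.isIdempotentElem_projection hn) with h0 | h1
  · left
    have hker : LinearMap.ker (a ^ n) = ⊥ := by
      rw [← Submodule.range_projection hn, h0, LinearMap.range_zero]
    have hrange : LinearMap.range (a ^ n) = ⊤ := by
      rw [← Submodule.ker_projection hn, h0, LinearMap.ker_zero]
    have := (Module.End.isUnit_iff _).2
      ⟨LinearMap.ker_eq_bot.1 hker, LinearMap.range_eq_top.1 hrange⟩
    exact (isUnit_pow_iff (by omega)).1 this
  · right
    have hker : LinearMap.ker (a ^ n) = ⊤ := by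
      rw [← Submodule.range_projection hn, h1]
      exact LinearMap.range_id
    exact IsNilpotent.isUnit_one_sub ⟨n, LinearMap.ker_eq_top.1 hker⟩

end LinearAlgebra

section TracePairing

variable {k : Type} [Field k] {M N : Type} [AddCommGroup M] [Module k M] [AddCommGroup N]
  [Module k N] [Module.Finite k N]

lemma eq_zero_of_trace_comp_eq_zero {y : M →ₗ[k] N}
    (h : ∀ θ : N →ₗ[k] M, LinearMap.trace k N (y ∘ₗ θ) = 0) : y = 0 := by
  ext m
  refine (Module.forall_dual_apply_eq_zero_iff k (y m)).1 fun φ ↦ ?_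
  rw [← LinearMap.trace_smulRight, ← h (φ.smulRight m)]
  congr 1
  ext
  simp

lemma exists_eq_trace_comp [Module.Finite k M] (l : (M →ₗ[k] N) →ₗ[k] k) :
    ∃ r : N →ₗ[k] M, ∀ x, l x = LinearMap.trace k N (x ∘ₗ r) := by
  let Θ : (N →ₗ[k] M) →ₗ[k] Module.Dual k (M →ₗ[k] N) :=
    ((LinearMap.llcomp k N M N).flip).compr₂ (LinearMap.trace k N)
  have hinj : Function.Injective Θ := by
    refine (injective_iff_map_eq_zero Θ).2 fun r hr ↦ eq_zero_of_trace_comp_eq_zero fun x ↦ ?_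
    rw [LinearMap.trace_comp_comm']
    exact LinearMap.congr_fun hr x
  have hsurj := (LinearMap.injective_iff_surjective_of_finrank_eq_finrank (by
    rw [Subspace.dual_finrank_eq, Module.finrank_linearMap, Module.finrank_linearMap,
      mul_comm])).1 hinj
  obtain ⟨r, hr⟩ := hsurj l
  exact ⟨r, fun x ↦ by rw [← hr]; rfl⟩

end TracePairing

section Duality

variable {k G : Type} [Field k] [Group G]
variable {M : Type} [AddCommGroup M] [Module k M] [Module (MonoidAlgebra k G) M]
  [IsScalarTower k (MonoidAlgebra k G) M]
variable {N : Type} [AddCommGroup N] [Module k N] [Module (MonoidAlgebra k G) N]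
  [IsScalarTower k (MonoidAlgebra k G) N]

lemma mem_span_sub_conjugate [Module.Finite k M] [Module.Finite k N] {y : M →ₗ[k] N}
    (hy : ∀ r : N →ₗ[MonoidAlgebra k G] M,
      LinearMap.trace k N (y ∘ₗ r.restrictScalars k) = 0) :
    y ∈ Submodule.span k {z | ∃ (x : M →ₗ[k] N) (γ : G), z = x - x.conjugate γ} := by
  by_contra hmem
  obtain ⟨l, hl, hlJ⟩ := Submodule.exists_le_ker_of_notMem hmem
  obtain ⟨r, hr⟩ := exists_eq_trace_comp l
  have hcomm (γ : G) : MonoidAlgebra.GroupSMul.linearMap k M γ ∘ₗ r =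
      r ∘ₗ MonoidAlgebra.GroupSMul.linearMap k N γ := by
    have hzero : r - MonoidAlgebra.GroupSMul.linearMap k M γ ∘ₗ r ∘ₗ
        MonoidAlgebra.GroupSMul.linearMap k N γ⁻¹ = 0 := by
      refine eq_zero_of_trace_comp_eq_zero fun x ↦ ?_
      have hx : l (x - x.conjugate γ) = 0 := hlJ (Submodule.subset_span ⟨x, γ, rfl⟩)
      rw [map_sub, hr, hr] at hx
      rw [LinearMap.trace_comp_comm', LinearMap.comp_sub, map_sub, ← hx]
      congr 1
      exact LinearMap.trace_mul_comm k
        (x ∘ₗ MonoidAlgebra.GroupSMul.linearMap k M γ ∘ₗ r)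
        (MonoidAlgebra.GroupSMul.linearMap k N γ⁻¹)
    ext n
    have := LinearMap.congr_fun hzero (MonoidAlgebra.single γ (1 : k) • n)
    simp only [LinearMap.sub_apply, LinearMap.comp_apply, LinearMap.zero_apply, sub_eq_zero,
      MonoidAlgebra.GroupSMul.linearMap_apply, smul_smul, MonoidAlgebra.single_mul_single,
      inv_mul_cancel, mul_one, ← MonoidAlgebra.one_def, one_smul] at this
    exact this.symm
  let r' : N →ₗ[MonoidAlgebra k G] M :=
    MonoidAlgebra.equivariantOfLinearOfComm r fun g n ↦ (LinearMap.congr_fun (hcomm g) n).symm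
  refine hl ?_
  rw [hr, ← hy r']
  rfl

variable [Fintype G]

lemma exists_transfer_eq_zero_trace_ne_zero [Module.Finite k N]
    [IsLocalRing (Module.End (MonoidAlgebra k G) N)]
    (hN : ∀ θ : N →ₗ[k] N, (transfer θ : N →ₗ[MonoidAlgebra k G] N) ≠ LinearMap.id) :
    ∃ h : N →ₗ[k] N, (transfer h : N →ₗ[MonoidAlgebra k G] N) = 0 ∧ LinearMap.trace k N h ≠ 0 ∧
      ∀ x : Module.End (MonoidAlgebra k G) N, ¬ IsUnit x →
        LinearMap.trace k N (h ∘ₗ x.restrictScalars k) = 0 := by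
  let J : Submodule k (N →ₗ[k] N) :=
    { carrier := {y | ∃ x : Module.End (MonoidAlgebra k G) N, ¬ IsUnit x ∧ x.restrictScalars k = y}
      zero_mem' := ⟨0, not_isUnit_zero, rfl⟩
      add_mem' := by
        rintro _ _ ⟨a, ha, rfl⟩ ⟨b, hb, rfl⟩
        exact ⟨a + b, IsLocalRing.nonunits_add ha hb, rfl⟩
      smul_mem' := by
        rintro c _ ⟨a, ha, rfl⟩
        refine ⟨c • a, fun h ↦ ha ?_, rfl⟩
        rcases eq_or_ne c 0 with rfl | hc
        · simp at h
        · simpa [Units.smul_def, smul_smul, hc] using h.smul (Units.mk0 c hc)⁻¹ }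
  have hJ : (LinearMap.id : N →ₗ[k] N) ∉ J := by
    rintro ⟨x, hx, hx'⟩
    refine hx ?_
    have : x = 1 := by
      ext n
      exact LinearMap.congr_fun hx' n
    exact this ▸ isUnit_one
  obtain ⟨l, hl, hlJ⟩ := Submodule.exists_le_ker_of_notMem hJ
  obtain ⟨h, hh⟩ := exists_eq_trace_comp l
  have hx (x : Module.End (MonoidAlgebra k G) N) (hx : ¬ IsUnit x) :
      LinearMap.trace k N (h ∘ₗ x.restrictScalars k) = 0 := by
    rw [LinearMap.trace_comp_comm', ← hh]
    exact hlJ ⟨x, hx, rfl⟩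
  refine ⟨h, ?_, by simpa [hh] using hl, hx⟩
  have : (transfer h : N →ₗ[MonoidAlgebra k G] N).restrictScalars k = 0 := by
    refine eq_zero_of_trace_comp_eq_zero fun θ ↦ ?_
    rw [trace_transfer_comp]
    refine hx _ ?_
    rintro ⟨u, hu⟩
    refine hN (θ ∘ₗ (u⁻¹).1.restrictScalars k) ?_
    rw [← transfer_comp, ← hu]
    exact u.mul_inv
  ext n
  exact LinearMap.congr_fun this n

end Duality

section StableTransfer

variable {k G : Type} [Field k] [Group G] [Fintype G]
variable {M X P Z : Type}
  [AddCommGroup M] [Module k M] [Module (MonoidAlgebra k G) M]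
  [IsScalarTower k (MonoidAlgebra k G) M]
  [AddCommGroup X] [Module k X] [Module (MonoidAlgebra k G) X]
  [IsScalarTower k (MonoidAlgebra k G) X]
  [AddCommGroup P] [Module k P] [Module (MonoidAlgebra k G) P]
  [IsScalarTower k (MonoidAlgebra k G) P]
  [AddCommGroup Z] [Module k Z] [Module (MonoidAlgebra k G) Z]
  [IsScalarTower k (MonoidAlgebra k G) Z]
variable {N : Type} [AddCommGroup N] [Module k N] [Module (MonoidAlgebra k G) N]
  [IsScalarTower k (MonoidAlgebra k G) N]

lemma exists_transfer_comp_eq {i : X →ₗ[MonoidAlgebra k G] P} {p : P →ₗ[MonoidAlgebra k G] Z}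
    (hi : Function.Injective i) (hexact : ∀ y, p y = 0 → ∃ x, i x = y)
    {σ : N →ₗ[k] P} {v : N →ₗ[MonoidAlgebra k G] Z}
    (hσ : p.restrictScalars k ∘ₗ σ = v.restrictScalars k) {y : M →ₗ[k] N}
    (hy : y ∈ Submodule.span k {z | ∃ (x : M →ₗ[k] N) (γ : G), z = x - x.conjugate γ}) :
    ∃ θ : M →ₗ[k] X, (transfer (σ ∘ₗ y) : M →ₗ[MonoidAlgebra k G] P) = i ∘ₗ transfer θ := by
  simp_rw [comp_transfer]
  induction hy using Submodule.span_induction with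
  | mem z hz =>
    obtain ⟨x, γ, rfl⟩ := hz
    obtain ⟨τ, hτ⟩ := exists_comp_eq_of_range_le (i := i.restrictScalars k) hi
      (f := σ - σ.conjugate γ⁻¹) (fun n ↦ hexact _ (by
        have h : p.restrictScalars k ∘ₗ (σ - σ.conjugate γ⁻¹) = 0 := by
          rw [LinearMap.comp_sub, conjugate_comp_left, hσ, conjugate_restrictScalars, sub_self]
        exact LinearMap.congr_fun h n))
    refine ⟨τ ∘ₗ x, ?_⟩
    rw [← LinearMap.comp_assoc, hτ, LinearMap.comp_sub, LinearMap.sub_comp, map_sub, map_sub,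
      comp_conjugate, transfer_conjugate]
  | zero => exact ⟨0, by simp⟩
  | add a b _ _ ha hb =>
    obtain ⟨θa, ha⟩ := ha
    obtain ⟨θb, hb⟩ := hb
    exact ⟨θa + θb, by simp [LinearMap.comp_add, ha, hb]⟩
  | smul c a _ ha =>
    obtain ⟨θ, hθ⟩ := ha
    refine ⟨c • θ, ?_⟩
    have (L : Type) [AddCommGroup L] [Module k L] [Module (MonoidAlgebra k G) L]
        [IsScalarTower k (MonoidAlgebra k G) L] (t : M →ₗ[k] L) :
        (transfer (c • t) : M →ₗ[MonoidAlgebra k G] L) = c • transfer t := by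
      ext m
      simp only [transfer_apply, LinearMap.smul_apply, Finset.smul_sum]
      exact Finset.sum_congr rfl fun g _ ↦ smul_comm _ _ _
    rw [LinearMap.comp_smul, LinearMap.comp_smul, this, this, hθ]

lemma trace_eq_zero_of_transfer_comp_eq [Module.Finite k N]
    [Module.Projective (MonoidAlgebra k G) P]
    {i : X →ₗ[MonoidAlgebra k G] P} {p : P →ₗ[MonoidAlgebra k G] Z}
    (hip : p ∘ₗ i = 0) {σ : N →ₗ[k] P} {u : Z →ₗ[MonoidAlgebra k G] N}
    {v : N →ₗ[MonoidAlgebra k G] Z} {ζ : N →ₗ[k] N} (huv : u ∘ₗ v - LinearMap.id = transfer ζ)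
    (hσ : p.restrictScalars k ∘ₗ σ = v.restrictScalars k)
    {h : N →ₗ[k] N} (hh : (transfer h : N →ₗ[MonoidAlgebra k G] N) = 0) {θ : N →ₗ[k] X}
    (hθ : (transfer (σ ∘ₗ h) : N →ₗ[MonoidAlgebra k G] P) = i ∘ₗ transfer θ) :
    LinearMap.trace k N h = 0 := by
  obtain ⟨η, hη⟩ := exists_transfer_eq_id (k := k) (G := G) (M := P)
  set d : N →ₗ[k] P := σ ∘ₗ h - i.restrictScalars k ∘ₗ θ with hd
  have hTd : (transfer d : N →ₗ[MonoidAlgebra k G] P) = 0 := by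
    rw [hd, map_sub, hθ, comp_transfer, sub_self]
  have hud : (u ∘ₗ p).restrictScalars k ∘ₗ d =
      h + (transfer ζ : N →ₗ[MonoidAlgebra k G] N).restrictScalars k ∘ₗ h := by
    ext n
    have h₁ : p (i (θ n)) = 0 := LinearMap.congr_fun hip _
    have h₂ : p (σ (h n)) = v (h n) := LinearMap.congr_fun hσ _
    rw [← huv]
    simp [hd, h₁, h₂]
  have hu : u ∘ₗ p = transfer ((u ∘ₗ p).restrictScalars k ∘ₗ η) := by
    rw [← comp_transfer, hη, LinearMap.comp_id]
  have h0 := congrArg (LinearMap.trace k N) hud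
  rw [map_add, hu, trace_transfer_comp, trace_transfer_comp, hTd, hh] at h0
  simpa using h0.symm

end StableTransfer

section Stable

variable {A : Type} [Ring A] {X Y Z W P : ModuleCat.{0} A}

lemma StablyZero.comp_left {f : X ⟶ Y} (hf : StablyZero f) (g : W ⟶ X) : StablyZero (g ≫ f) := by
  obtain ⟨Q, hQ, a, b, rfl⟩ := hf
  exact ⟨Q, hQ, g ≫ a, b, (Category.assoc _ _ _).symm⟩

lemma StablyZero.comp_right {f : X ⟶ Y} (hf : StablyZero f) (g : Y ⟶ W) : StablyZero (f ≫ g) := by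
  obtain ⟨Q, hQ, a, b, rfl⟩ := hf
  exact ⟨Q, hQ, a, b ≫ g, Category.assoc _ _ _⟩

lemma projective_of_stablyZero_id (h : StablyZero (𝟙 X)) : Projective X := by
  obtain ⟨Q, hQ, a, b, hab⟩ := h
  exact Retract.projective ⟨a, b, hab.symm⟩

lemma StablyIso.symm (h : StablyIso X Y) : StablyIso Y X := by
  obtain ⟨f, g, hf, hg⟩ := h
  exact ⟨g, f, hg, hf⟩

namespace SES

lemma i_comp_p (S : SES X Y Z) : S.i ≫ S.p = 0 := by
  ext x
  exact (S.exact _).2 ⟨x, rfl⟩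

lemma exists_lift (S : SES X Y Z) {f : W ⟶ Y} (hf : f ≫ S.p = 0) : ∃ g : W ⟶ X, g ≫ S.i = f := by
  obtain ⟨g, hg⟩ := exists_comp_eq_of_range_le (i := S.i.hom) S.inj (f := f.hom)
    fun w ↦ (S.exact _).1 (congrArg (fun t ↦ t.hom w) hf)
  exact ⟨ModuleCat.ofHom g, ModuleCat.hom_ext hg⟩

lemma exists_desc (S : SES X Y Z) {f : Y ⟶ W} (hf : S.i ≫ f = 0) : ∃ g : Z ⟶ W, S.p ≫ g = f := by
  obtain ⟨g, hg⟩ := exists_comp_eq_of_ker_le (p := S.p.hom) S.surj (f := f.hom) fun y hy ↦ by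
    obtain ⟨x, rfl⟩ := (S.exact y).1 hy
    exact congrArg (fun t ↦ t.hom x) hf
  exact ⟨ModuleCat.ofHom g, ModuleCat.hom_ext hg⟩

lemma epi (S : SES X Y Z) : Epi S.p := (ModuleCat.epi_iff_surjective _).2 S.surj

lemma mono (S : SES X Y Z) : Mono S.i := (ModuleCat.mono_iff_injective _).2 S.inj

end SES

end Stable

section StableGroupAlgebra

open scoped ModuleCat

variable {k G : Type} [Field k] [Group G]
  {X Y Z W P N : ModuleCat.{0} (MonoidAlgebra k G)}

lemma StablyZero.smul {f : X ⟶ Y} (hf : StablyZero f) (c : k) : StablyZero (c • f) := by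
  simpa using hf.comp_right (c • 𝟙 Y)

/-- Every endomorphism of `X` is a scalar in the stable category. -/
def StablyScalarEnd (X : ModuleCat.{0} (MonoidAlgebra k G)) : Prop :=
  ∀ f : X ⟶ X, ∃ c : k, StablyZero (f - c • 𝟙 X)

lemma StablyScalarEnd.stablyIso_of_retract (hX : StablyScalarEnd X) (hN : ¬ Projective N)
    {s : N ⟶ X} {g : X ⟶ N} (hsg : s ≫ g = 𝟙 N) : StablyIso N X := by
  obtain ⟨c, hc⟩ := hX (g ≫ s)
  have h₁ := (hc.comp_left s).comp_right g
  have h₂ : StablyZero ((1 - c) • 𝟙 N) := by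
    convert h₁ using 1
    simp [Preadditive.sub_comp, Preadditive.comp_sub, hsg, reassoc_of% hsg, sub_smul]
  have hc1 : c = 1 := by
    by_contra hne
    refine hN (projective_of_stablyZero_id ?_)
    have := h₂.smul (1 - c)⁻¹
    rwa [smul_smul, inv_mul_cancel₀ (sub_ne_zero.2 (Ne.symm hne)), one_smul] at this
  refine ⟨s, g, ?_, by simpa [hc1] using hc⟩
  simpa [hsg] using h₂.smul 0

variable [Fintype G]

lemma stablyZero_iff {f : X ⟶ Y} : StablyZero f ↔ ∃ θ : X →ₗ[k] Y, f.hom = transfer θ := by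
  constructor
  · rintro ⟨Q, hQ, a, b, rfl⟩
    obtain ⟨η, hη⟩ := exists_transfer_eq_id (k := k) (G := G) (M := Q)
    refine ⟨b.hom.restrictScalars k ∘ₗ η ∘ₗ a.hom.restrictScalars k, ?_⟩
    rw [← comp_transfer, ← transfer_comp, hη]
    rfl
  · rintro ⟨θ, hθ⟩
    refine ⟨ModuleCat.of _ (TensorProduct k (MonoidAlgebra k G) Y), inferInstance,
      ModuleCat.ofHom (transfer (TensorProduct.mk k (MonoidAlgebra k G) Y 1 ∘ₗ θ)),
      ModuleCat.ofHom (actionMap k G Y), ModuleCat.hom_ext ?_⟩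
    rw [hθ, transfer_eq_actionMap_comp]
    rfl

lemma StablyZero.add {f g : X ⟶ Y} (hf : StablyZero f) (hg : StablyZero g) :
    StablyZero (f + g) := by
  obtain ⟨θ, hθ⟩ := stablyZero_iff.1 hf
  obtain ⟨ζ, hζ⟩ := stablyZero_iff.1 hg
  exact stablyZero_iff.2 ⟨θ + ζ, by rw [ModuleCat.hom_add, hθ, hζ, map_add]⟩

lemma exists_extension {f : X ⟶ Y} (hf : Function.Injective f) (g : X ⟶ W) [Projective W] :
    ∃ F : Y ⟶ W, f ≫ F = g := by
  obtain ⟨η, hη⟩ := exists_transfer_eq_id (k := k) (G := G) (M := W)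
  obtain ⟨ρ, hρ⟩ := (f.hom.restrictScalars k).exists_leftInverse_of_injective
    (LinearMap.ker_eq_bot.2 hf)
  refine ⟨ModuleCat.ofHom (transfer (η ∘ₗ g.hom.restrictScalars k ∘ₗ ρ)), ModuleCat.hom_ext ?_⟩
  change transfer _ ∘ₗ f.hom = g.hom
  rw [transfer_comp, LinearMap.comp_assoc, LinearMap.comp_assoc, hρ, LinearMap.comp_id,
    ← transfer_comp, hη, LinearMap.id_comp]

lemma SES.stablyZero_iff (S : SES X P Z) [Projective P] {x : X ⟶ X} {y : P ⟶ P} {z : Z ⟶ Z}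
    (hxy : x ≫ S.i = S.i ≫ y) (hyz : y ≫ S.p = S.p ≫ z) : StablyZero x ↔ StablyZero z := by
  have := S.epi
  have := S.mono
  constructor
  · rintro ⟨Q, hQ, a, b, rfl⟩
    obtain ⟨F, hF⟩ := exists_extension S.inj a
    obtain ⟨v, hv⟩ := S.exists_desc (f := y - (F ≫ b) ≫ S.i) (by
      rw [Preadditive.comp_sub, ← hxy, ← Category.assoc, ← Category.assoc, hF, sub_self])
    refine ⟨P, inferInstance, v, S.p, ?_⟩
    rw [← cancel_epi S.p, ← Category.assoc, hv, Preadditive.sub_comp, Category.assoc, S.i_comp_p,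
      Limits.comp_zero, sub_zero, hyz]
  · rintro ⟨Q, hQ, a, b, rfl⟩
    let v := a ≫ Projective.factorThru b S.p
    have hv : v ≫ S.p = a ≫ b := by simp [v]
    obtain ⟨w, hw⟩ := S.exists_lift (f := y - S.p ≫ v) (by
      rw [Preadditive.sub_comp, Category.assoc, hv, hyz, sub_self])
    refine ⟨P, inferInstance, S.i, w, ?_⟩
    rw [← cancel_mono S.i, Category.assoc, hw, Preadditive.comp_sub, ← Category.assoc S.i,
      S.i_comp_p, Limits.zero_comp, sub_zero, hxy]

lemma SES.stablyScalarEnd_iff (S : SES X P Z) [Projective P] :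
    StablyScalarEnd X ↔ StablyScalarEnd Z := by
  have := S.epi
  have hS {x : X ⟶ X} {y : P ⟶ P} {z : Z ⟶ Z} (hxy : x ≫ S.i = S.i ≫ y)
      (hyz : y ≫ S.p = S.p ≫ z) (c : k) :
      StablyZero (x - c • 𝟙 X) ↔ StablyZero (z - c • 𝟙 Z) := by
    refine S.stablyZero_iff (y := y - c • 𝟙 P) ?_ ?_
    · simp [Preadditive.sub_comp, Preadditive.comp_sub, hxy]
    · simp [Preadditive.sub_comp, Preadditive.comp_sub, hyz]
  constructor
  · intro h z
    have hy := Projective.factorThru_comp (S.p ≫ z) S.p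
    obtain ⟨x, hx⟩ := S.exists_lift (f := S.i ≫ Projective.factorThru (S.p ≫ z) S.p) (by
      rw [Category.assoc, hy, ← Category.assoc, S.i_comp_p, Limits.zero_comp])
    obtain ⟨c, hc⟩ := h x
    exact ⟨c, (hS hx hy c).1 hc⟩
  · intro h x
    obtain ⟨y, hy⟩ := exists_extension S.inj (x ≫ S.i)
    obtain ⟨z, hz⟩ := S.exists_desc (f := y ≫ S.p) (by
      rw [← Category.assoc, hy, Category.assoc, S.i_comp_p, Limits.comp_zero])
    obtain ⟨c, hc⟩ := h z
    exact ⟨c, (hS hy.symm hz.symm c).2 hc⟩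

lemma StablyScalarEnd.of_stablyIso (h : StablyScalarEnd X) (hXY : StablyIso X Y) :
    StablyScalarEnd Y := by
  intro f
  obtain ⟨a, b, -, hba⟩ := hXY
  obtain ⟨c, hc⟩ := h (a ≫ f ≫ b)
  refine ⟨c, ?_⟩
  have h₁ := (hc.comp_left b).comp_right a
  have h₂ := (hba.comp_right f).add ((hba.comp_left (b ≫ a ≫ f)))
  have h₃ := (h₁.add (hba.smul c)).add (h₂.smul (-1))
  convert h₃ using 1
  simp [Preadditive.sub_comp, Preadditive.comp_sub, smul_sub]
  abel

lemma stablyScalarEnd_triv : StablyScalarEnd (triv k G) := by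
  intro f
  let ρ := Representation.trivial k (G := G) (V := k)
  have hsymm (c : k) : (ρ.asModuleEquiv.symm c : ρ.asModule) =
      algebraMap k (MonoidAlgebra k G) c • ρ.asModuleEquiv.symm 1 := by
    rw [← ρ.asModuleEquiv_symm_map_smul, smul_eq_mul, mul_one]
  let F : ρ.asModule →ₗ[MonoidAlgebra k G] ρ.asModule := f.hom
  let c : k := ρ.asModuleEquiv (F (ρ.asModuleEquiv.symm 1))
  have hF (x : ρ.asModule) : F x = algebraMap k (MonoidAlgebra k G) c • x := by
    obtain ⟨a, rfl⟩ := ρ.asModuleEquiv.symm.surjective x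
    rw [hsymm a, map_smul, smul_smul, Algebra.commutes, mul_smul, ← hsymm c,
      LinearEquiv.symm_apply_apply]
  refine ⟨c, stablyZero_iff.2 ⟨0, ?_⟩⟩
  rw [map_zero]
  ext x
  exact sub_eq_zero.2 (hF x)

lemma IsSyzygyFamily.stablyScalarEnd {Ω : ℤ → ModuleCat.{0} (MonoidAlgebra k G)}
    (hX : StablyScalarEnd X) (hΩ : IsSyzygyFamily X Ω) (i : ℤ) : StablyScalarEnd (Ω i) := by
  have hstep (j : ℤ) : StablyScalarEnd (Ω (j + 1)) ↔ StablyScalarEnd (Ω j) := by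
    obtain ⟨P, hP, ⟨S⟩⟩ := hΩ.2.2 j
    exact S.stablyScalarEnd_iff
  induction i using Int.induction_on with
  | zero => exact hX.of_stablyIso hΩ.2.1.symm
  | succ i hi => exact (hstep i).2 hi
  | pred i hi => exact (hstep _).1 (by simpa using hi)

lemma exists_map_annihilating_nonsplit [Module.Finite k N] (hind : Indecomp N)
    (hnp : ¬ Projective N) (S : SES X P Z) [Projective P] (hNZ : StablyIso N Z) :
    ∃ φ : N ⟶ X, ¬ StablyZero φ ∧ ∀ (M : ModuleCat.{0} (MonoidAlgebra k G)) [Module.Finite k M]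
      (g : M ⟶ N), (¬ ∃ s : N ⟶ M, s ≫ g = 𝟙 N) → StablyZero (g ≫ φ) := by
  obtain ⟨v, u, hvu, -⟩ := hNZ
  obtain ⟨ζ, hζ⟩ := StmodGH.stablyZero_iff.1 hvu
  have : IsNoetherian (MonoidAlgebra k G) N := isNoetherian_of_tower k inferInstance
  have : IsArtinian (MonoidAlgebra k G) N := isArtinian_of_tower k inferInstance
  have : Nontrivial N := by
    by_contra h
    rw [not_nontrivial_iff_subsingleton] at h
    exact hind.1 (ModuleCat.isZero_of_subsingleton N)
  have : IsLocalRing (Module.End (MonoidAlgebra k G) N) :=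
    isLocalRing_end_of_idempotents fun e he ↦ by
      rcases hind.2 (ModuleCat.ofHom e) (ModuleCat.hom_ext he) with h | h
      · exact Or.inl (congrArg ModuleCat.Hom.hom h)
      · exact Or.inr (congrArg ModuleCat.Hom.hom h)
  obtain ⟨h, hh, htr, hx⟩ := exists_transfer_eq_zero_trace_ne_zero (k := k) (G := G) (N := N)
    fun θ hθ ↦ hnp (projective_of_stablyZero_id (StmodGH.stablyZero_iff.2 ⟨θ, hθ.symm⟩))
  obtain ⟨τ, hτ⟩ := (S.p.hom.restrictScalars k).exists_rightInverse_of_surjective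
    (LinearMap.range_eq_top.2 S.surj)
  let σ : N →ₗ[k] P := τ ∘ₗ v.hom.restrictScalars k
  have hσ : S.p.hom.restrictScalars k ∘ₗ σ = v.hom.restrictScalars k := by
    rw [← LinearMap.comp_assoc, hτ, LinearMap.id_comp]
  obtain ⟨φ, hφ⟩ := S.exists_lift (f := ModuleCat.ofHom (transfer (σ ∘ₗ h))) (by
    apply ModuleCat.hom_ext
    change S.p.hom ∘ₗ transfer (σ ∘ₗ h) = 0
    rw [comp_transfer, ← LinearMap.comp_assoc, hσ, ← comp_transfer, hh, LinearMap.comp_zero])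
  have hφ' : S.i.hom ∘ₗ φ.hom = transfer (σ ∘ₗ h) := congrArg ModuleCat.Hom.hom hφ
  refine ⟨φ, fun hzero ↦ ?_, fun M _ g hg ↦ ?_⟩
  · obtain ⟨θ, hθ⟩ := StmodGH.stablyZero_iff.1 hzero
    refine htr (trace_eq_zero_of_transfer_comp_eq (i := S.i.hom) (p := S.p.hom) (u := u.hom)
      (v := v.hom) (ζ := ζ) (congrArg ModuleCat.Hom.hom S.i_comp_p) hζ hσ hh (θ := θ) ?_)
    rw [← hφ', hθ]
  · have hmem := mem_span_sub_conjugate (G := G) (y := h ∘ₗ g.hom.restrictScalars k) fun r ↦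
      hx (g.hom ∘ₗ r) fun ⟨w, hw⟩ ↦ hg ⟨ModuleCat.ofHom (r ∘ₗ w⁻¹.1), ModuleCat.hom_ext (by
        change g.hom ∘ₗ r ∘ₗ w⁻¹.1 = LinearMap.id
        rw [← LinearMap.comp_assoc, ← hw]
        exact w.mul_inv)⟩
    obtain ⟨θ, hθ⟩ := exists_transfer_comp_eq (i := S.i.hom) S.inj
      (fun y ↦ (S.exact y).1) hσ hmem
    refine StmodGH.stablyZero_iff.2 ⟨θ, ?_⟩
    ext m
    apply S.inj
    have h₁ := LinearMap.congr_fun hφ' (g.hom m)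
    have h₂ := LinearMap.congr_fun hθ m
    rw [← LinearMap.comp_assoc, ← transfer_comp, ← hφ'] at h₂
    exact h₂

end StableGroupAlgebra

/-- If there is a finitely generated indecomposable non-projective module
`N` in the thick subcategory generated by `k` which is not stably isomorphic to `Ω^i k`
for any `i`, then there is a nonzero map `φ : N ⟶ ΩN` in the stable category inducing the
zero map on Tate cohomology (a nontrivial ghost); in particular the generating hypothesis
fails for `kG`. -/
theorem exists_nontrivial_ghost_of_exotic_indecomposable
    (k G : Type) [Field k] [Group G] [Fintype G]
    (p : ℕ) [Fact p.Prime] [CharP k p] (hp : p ∣ Fintype.card G)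
    (Ωk : ℤ → ModuleCat (MonoidAlgebra k G)) (hΩk : IsSyzygyFamily (triv k G) Ωk)
    (N : ModuleCat (MonoidAlgebra k G)) [Module.Finite (MonoidAlgebra k G) N]
    (hind : Indecomp N) (hnp : ¬ Projective N)
    (hthick : InThick (triv k G) N)
    (hnot : ∀ i : ℤ, ¬ StablyIso N (Ωk i))
    (ΩN : ℤ → ModuleCat (MonoidAlgebra k G)) (hΩN : IsSyzygyFamily N ΩN) :
    (∃ φ : N ⟶ ΩN 1, ¬ StablyZero φ ∧
        ∀ (i : ℤ) (g : Ωk i ⟶ N), StablyZero (g ≫ φ)) ∧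
      ¬ GHolds k G := by
  open scoped ModuleCat in
  have hfin (M : ModuleCat.{0} (MonoidAlgebra k G)) (_ : Module.Finite (MonoidAlgebra k G) M) :
      Module.Finite k M := Module.Finite.trans (MonoidAlgebra k G) M
  obtain ⟨P, hP, ⟨S⟩⟩ := hΩN.2.2 0
  have := hfin N inferInstance
  obtain ⟨φ, hφ, hghost⟩ := exists_map_annihilating_nonsplit hind hnp S hΩN.2.1.symm
  have hφΩ (i : ℤ) (g : Ωk i ⟶ N) : StablyZero (g ≫ φ) := by
    have := hfin _ (hΩk.1 i)
    refine hghost (Ωk i) g fun ⟨s, hs⟩ ↦ hnot i ?_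
    exact (hΩk.stablyScalarEnd stablyScalarEnd_triv i).stablyIso_of_retract hnp hs
  refine ⟨⟨φ, hφ, hφΩ⟩, fun hGH ↦ hφ (hGH Ωk hΩk N _ hthick ?_ φ hφΩ)⟩
  exact .ext₃ S (.proj P hP) (.iso hΩN.2.1.symm hthick)

end StmodGH
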